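/- For every (g,L) in the region R₁ = {(g,L) : 0 < g < 1, 0 ≤ L ≤ 1 − (5/6)g}, the unique real solution S̃ of the cubic equation (1−g)·S̃ + g·S̃³/6 = L is an approximate zero of f_{g,L}. -/

import Mathlib

noncomputable section

/-- The hyperbolic Kepler function `f_{g,L}(S) = S - g·arcsinh(S) - L`. -/
def fhk (g L : ℝ) : ℝ → ℝ := fun S => S - g * Real.arsinh S - L

/-- `β(f,z) = |f(z)/f'(z)|`. -/
def betaFn (f : ℝ → ℝ) (z : ℝ) : ℝ := |f z / deriv f z|

/-- `γ(f,z) = sup_{k ≥ 2} |f^{(k)}(z)/(k!·f'(z))|^{1/(k-1)}`. -/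
def gammaFn (f : ℝ → ℝ) (z : ℝ) : ℝ :=
  sSup {y : ℝ | ∃ k : ℕ, 2 ≤ k ∧
    y = |iteratedDeriv k f z / (Nat.factorial k * deriv f z)| ^ ((1 : ℝ) / ((k : ℝ) - 1))}

/-- `α(f,z) = β(f,z)·γ(f,z)`. -/
def alphaFn (f : ℝ → ℝ) (z : ℝ) : ℝ := betaFn f z * gammaFn f z

/-- Smale's constant (improved by Wang–Han): `α₀ = 3 - 2√2`. -/
def alpha0 : ℝ := 3 - 2 * Real.sqrt 2

/-- `z` is an approximate zero of `f` when `α(f,z) < α₀`. -/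
def ApproxZero (f : ℝ → ℝ) (z : ℝ) : Prop := alphaFn f z < alpha0


theorem leg_bound (p : ℕ → ℝ) (t : ℝ) (ht : t ^ 2 < 1) (h0 : p 0 = 1) (h1 : p 1 = -t)
    (hr : ∀ n : ℕ, ((n : ℝ) + 2) * p (n + 2) + (2 * n + 3) * t * p (n + 1) + (n + 1) * p n = 0)
    (n : ℕ) : |p n| ≤ 1 := by
  have hE : ∀ n : ℕ, p (n + 1) ^ 2 + 2 * t * p n * p (n + 1) + p n ^ 2 ≤ 1 - t ^ 2 := by
    intro n
    induction n with
    | zero => simp only [zero_add, h0, h1]; nlinarith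
    | succ n ih =>
      have h := hr n
      have hn : (0 : ℝ) ≤ n := Nat.cast_nonneg n
      have e : p (n + 2) + t * p (n + 1) =
          -(((n : ℝ) + 1) / (n + 2)) * (t * p (n + 1) + p n) := by
        have : (n : ℝ) + 2 ≠ 0 := by positivity
        field_simp
        linarith
      have hc : (((n : ℝ) + 1) / (n + 2)) ^ 2 ≤ 1 := by
        rw [sq_le_one_iff_abs_le_one, abs_of_nonneg (by positivity), div_le_one (by positivity)]
        linarith
      have e2 : (p (n + 2) + t * p (n + 1)) ^ 2 ≤ (t * p (n + 1) + p n) ^ 2 := by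
        rw [e, mul_pow, neg_sq]
        nlinarith [sq_nonneg (t * p (n + 1) + p n)]
      show p (n + 2) ^ 2 + 2 * t * p (n + 1) * p (n + 2) + p (n + 1) ^ 2 ≤ 1 - t ^ 2
      nlinarith
  have h := hE n
  rw [← sq_le_one_iff_abs_le_one]
  have h2 : (1 - t ^ 2) * p n ^ 2 ≤ (1 - t ^ 2) * 1 := by
    nlinarith [sq_nonneg (p (n + 1) + t * p n)]
  exact le_of_mul_le_mul_left h2 (by linarith)

def yf : ℝ → ℝ := fun x => (Real.sqrt (1 + x ^ 2))⁻¹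

theorem deriv_arsinh_eq : deriv Real.arsinh = yf := by
  funext x
  exact (Real.hasDerivAt_arsinh x).deriv

theorem yf_contDiff : ContDiff ℝ (⊤ : ℕ∞) yf := by
  unfold yf
  refine ContDiff.inv (ContDiff.sqrt (by fun_prop) ?_) ?_
  · intro x; positivity
  · intro x; positivity

theorem yf_hasDeriv (n : ℕ) (x : ℝ) :
    HasDerivAt (iteratedDeriv n yf) (iteratedDeriv (n + 1) yf x) x := by
  rw [iteratedDeriv_succ]
  apply DifferentiableAt.hasDerivAt
  have := yf_contDiff.differentiable_iteratedDeriv n (by exact_mod_cast WithTop.coe_lt_top _)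
  exact this x

theorem yf_ode (x : ℝ) : (1 + x ^ 2) * iteratedDeriv 1 yf x + x * iteratedDeriv 0 yf x = 0 := by
  have hp : 0 < 1 + x ^ 2 := by positivity
  have h1 : HasDerivAt (fun x : ℝ => 1 + x ^ 2) (2 * x) x := by
    simpa using (hasDerivAt_pow 2 x).const_add 1
  have h := (h1.sqrt hp.ne').inv (by positivity)
  have h' : deriv yf x = _ := h.deriv
  rw [iteratedDeriv_one, iteratedDeriv_zero, h']
  unfold yf
  have hs := Real.sq_sqrt hp.le
  have hs0 : 0 < √(1 + x ^ 2) := by positivity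
  set r := √(1 + x ^ 2)
  rw [← hs]
  field_simp
  ring

theorem yf_rec (n : ℕ) : ∀ x : ℝ, (1 + x ^ 2) * iteratedDeriv (n + 2) yf x +
    (2 * n + 3) * x * iteratedDeriv (n + 1) yf x + (n + 1) ^ 2 * iteratedDeriv n yf x = 0 := by
  have hsq : ∀ x : ℝ, HasDerivAt (fun x : ℝ => 1 + x ^ 2) (2 * x) x := by
    intro x; simpa using (hasDerivAt_pow 2 x).const_add 1
  induction n with
  | zero =>
    intro x
    have h := ((hsq x).mul (yf_hasDeriv 1 x)).add ((hasDerivAt_id x).mul (yf_hasDeriv 0 x))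
    have h' := h.unique ((hasDerivAt_const x (0 : ℝ)).congr_of_eventuallyEq
      (Filter.Eventually.of_forall fun y => yf_ode y))
    simp only [id, zero_add, Nat.reduceAdd] at h' ⊢
    push_cast
    linarith
  | succ n ih =>
    intro x
    have h := (((hsq x).mul (yf_hasDeriv (n + 2) x)).add
      (((hasDerivAt_id x).const_mul (2 * (n : ℝ) + 3)).mul (yf_hasDeriv (n + 1) x))).add
      ((yf_hasDeriv n x).const_mul (((n : ℝ) + 1) ^ 2))
    have h' := h.unique ((hasDerivAt_const x (0 : ℝ)).congr_of_eventuallyEq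
      (Filter.Eventually.of_forall fun y => ih y))
    simp only [id] at h'
    push_cast
    simp only [show n + 1 + 2 = n + 2 + 1 from rfl, show n + 1 + 1 = n + 2 from rfl] at h' ⊢
    linarith

theorem yf_bound (n : ℕ) (x : ℝ) :
    |iteratedDeriv n yf x| ≤ n.factorial / √(1 + x ^ 2) ^ (n + 1) := by
  have hp : 0 < 1 + x ^ 2 := by positivity
  have hs := Real.sq_sqrt hp.le
  have hs0 : 0 < √(1 + x ^ 2) := by positivity
  have hrec := fun n => yf_rec n x
  have hode := yf_ode x
  have hy0 : iteratedDeriv 0 yf x = (√(1 + x ^ 2))⁻¹ := by rw [iteratedDeriv_zero]; rfl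
  set r := √(1 + x ^ 2)
  rw [← hs] at hode hrec
  have key := leg_bound (fun n => iteratedDeriv n yf x / n.factorial * r ^ (n + 1)) (x / r)
    (by rw [div_pow, div_lt_one (by positivity)]; linarith)
    (by simp only [hy0]; simp [hs0.ne'])
    (by
      rw [hy0] at hode
      have : iteratedDeriv 1 yf x = -(x * r⁻¹) / r ^ 2 := by
        field_simp at hode ⊢
        linarith
      simp only [this]; simp; field_simp)
    (by
      intro n
      have h := hrec n
      have hf : (n.factorial : ℝ) ≠ 0 := by positivity
      have h2 : ((n + 2).factorial : ℝ) = (n + 2) * ((n + 1) * n.factorial) := by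
        rw [Nat.factorial_succ, Nat.factorial_succ]; push_cast; ring
      have h3 : ((n + 1).factorial : ℝ) = (n + 1) * n.factorial := by
        rw [Nat.factorial_succ]; push_cast; ring
      simp only [h2, h3]
      have hn1 : (n : ℝ) + 1 ≠ 0 := by positivity
      have hn2 : (n : ℝ) + 2 ≠ 0 := by positivity
      have : ∀ A B C : ℝ, ((n : ℝ) + 2) * (A / ((n + 2) * ((n + 1) * n.factorial)) * r ^ (n + 2 + 1)) +
          (2 * n + 3) * (x / r) * (B / ((n + 1) * n.factorial) * r ^ (n + 1 + 1)) +
          (n + 1) * (C / n.factorial * r ^ (n + 1)) =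
          r ^ (n + 1) / ((n + 1) * n.factorial) *
          (r ^ 2 * A + (2 * n + 3) * x * B + (n + 1) ^ 2 * C) := by
        intro A B C
        field_simp
        try ring
      rw [this, h, mul_zero]) n
  simp only [abs_mul, abs_div, Nat.abs_cast, abs_of_pos (pow_pos hs0 (n + 1))] at key
  rw [le_div_iff₀ (by positivity)]
  have hf : (0 : ℝ) < n.factorial := by positivity
  rw [div_mul_eq_mul_div, div_le_one hf] at key
  exact key

theorem inv_sqrt_upper (u : ℝ) (h0 : 0 ≤ u) (h1 : u ≤ 1) :
    (√(1 + u))⁻¹ ≤ 1 - u / 2 + 3 / 8 * u ^ 2 - 3 / 20 * u ^ 3 := by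
  have hq : 0 < 1 - u / 2 + 3 / 8 * u ^ 2 - 3 / 20 * u ^ 3 := by
    nlinarith [mul_nonneg (sq_nonneg u) (sub_nonneg.2 h1), sq_nonneg u]
  rw [inv_le_comm₀ (by positivity) hq]
  apply Real.le_sqrt_of_sq_le
  rw [inv_pow, inv_le_iff_one_le_mul₀ (by positivity)]
  have h3 : 0 ≤ u ^ 3 := by positivity
  have h : 0 ≤ 13 / 40 - 123 / 320 * u + 57 / 320 * u ^ 2 - 9 / 100 * u ^ 3 + 9 / 400 * u ^ 4 := by
    have h2 : u ^ 3 ≤ u ^ 2 := pow_le_pow_of_le_one h0 h1 (by norm_num)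
    have h4 : 0 ≤ u ^ 4 := by positivity
    nlinarith [sq_nonneg (1 - u)]
  have h' := mul_nonneg h3 h
  have e : (1 + u) * (1 - u / 2 + 3 / 8 * u ^ 2 - 3 / 20 * u ^ 3) ^ 2 = 1 + u ^ 3 *
    (13 / 40 - 123 / 320 * u + 57 / 320 * u ^ 2 - 9 / 100 * u ^ 3 + 9 / 400 * u ^ 4) := by ring
  linarith

theorem inv_sqrt_lower (u : ℝ) (h0 : 0 ≤ u) : 1 - u / 2 ≤ (√(1 + u))⁻¹ := by
  have hs0 : 0 < √(1 + u) := by positivity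
  have hs := Real.sq_sqrt (show 0 ≤ 1 + u by linarith)
  set r := √(1 + u)
  have : u = r ^ 2 - 1 := by linarith
  rw [this, ← one_div, le_div_iff₀ hs0]
  nlinarith [mul_nonneg (sq_nonneg (r - 1)) (show 0 ≤ r + 2 by linarith)]

theorem D_bounds (S : ℝ) (h0 : 0 ≤ S) (h1 : S ≤ 1) :
    0 ≤ Real.arsinh S - S + S ^ 3 / 6 ∧ Real.arsinh S - S + S ^ 3 / 6 ≤ 3 / 56 * S ^ 4 := by
  have hd : ∀ x : ℝ, HasDerivAt (fun x => Real.arsinh x - x + x ^ 3 / 6)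
      ((√(1 + x ^ 2))⁻¹ - 1 + x ^ 2 / 2) x := by
    intro x
    refine (((Real.hasDerivAt_arsinh x).sub (hasDerivAt_id x)).add
      ((hasDerivAt_pow 3 x).div_const 6)).congr_deriv ?_
    norm_num; ring
  have hd2 : ∀ x : ℝ, HasDerivAt (fun x => 3 / 40 * x ^ 5 - 3 / 140 * x ^ 7 -
      (Real.arsinh x - x + x ^ 3 / 6))
      (3 / 8 * x ^ 4 - 3 / 20 * x ^ 6 - ((√(1 + x ^ 2))⁻¹ - 1 + x ^ 2 / 2)) x := by
    intro x
    refine ((((hasDerivAt_pow 5 x).const_mul (3 / 40)).sub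
      ((hasDerivAt_pow 7 x).const_mul (3 / 140))).sub (hd x)).congr_deriv ?_
    norm_num; ring
  have m1 : MonotoneOn (fun x => Real.arsinh x - x + x ^ 3 / 6) (Set.Icc 0 1) := by
    apply monotoneOn_of_deriv_nonneg (convex_Icc 0 1)
    · exact fun x _ => (hd x).continuousAt.continuousWithinAt
    · exact fun x _ => (hd x).differentiableAt.differentiableWithinAt
    · intro x _
      rw [(hd x).deriv]
      linarith [inv_sqrt_lower (x ^ 2) (sq_nonneg x)]
  have m2 : MonotoneOn (fun x => 3 / 40 * x ^ 5 - 3 / 140 * x ^ 7 -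
      (Real.arsinh x - x + x ^ 3 / 6)) (Set.Icc 0 1) := by
    apply monotoneOn_of_deriv_nonneg (convex_Icc 0 1)
    · exact fun x _ => (hd2 x).continuousAt.continuousWithinAt
    · exact fun x _ => (hd2 x).differentiableAt.differentiableWithinAt
    · intro x hx
      rw [interior_Icc] at hx
      rw [(hd2 x).deriv]
      have := inv_sqrt_upper (x ^ 2) (sq_nonneg x) (by nlinarith [hx.1, hx.2])
      nlinarith
  have a1 := m1 (Set.mem_Icc.2 ⟨le_rfl, zero_le_one⟩) (Set.mem_Icc.2 ⟨h0, h1⟩) h0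
  have a2 := m2 (Set.mem_Icc.2 ⟨le_rfl, zero_le_one⟩) (Set.mem_Icc.2 ⟨h0, h1⟩) h0
  simp at a1 a2
  refine ⟨by linarith, ?_⟩
  have h4 : 0 ≤ S ^ 4 := by positivity
  have : S * (3 / 40 - 3 / 140 * S ^ 2) ≤ 3 / 56 := by
    nlinarith [mul_nonneg (sub_nonneg.2 h1) (show 0 ≤ 1 - S by linarith), mul_nonneg h0 (sub_nonneg.2 h1), mul_nonneg (mul_nonneg h0 h0) (sub_nonneg.2 h1)]
  nlinarith

theorem fhk_deriv (g L : ℝ) : deriv (fhk g L) = fun x => 1 - g * yf x := by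
  funext x
  exact (((hasDerivAt_id x).sub ((Real.hasDerivAt_arsinh x).const_mul g)).sub_const L).deriv

theorem fhk_iter (g L : ℝ) (n : ℕ) (x : ℝ) :
    iteratedDeriv (n + 2) (fhk g L) x = -(g * iteratedDeriv (n + 1) yf x) := by
  rw [iteratedDeriv_succ', fhk_deriv, iteratedDeriv_succ', iteratedDeriv_succ']
  have : deriv (fun x => 1 - g * yf x) = fun x => (-g) * deriv yf x := by
    funext x
    have h := yf_hasDeriv 0 x
    rw [iteratedDeriv_zero, zero_add, iteratedDeriv_one] at h
    rw [((h.const_mul g).const_sub 1).deriv]; ring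
  rw [this, iteratedDeriv_const_mul_field]; ring

/-- Theorem 2.4: for `(g,L)` in `R₁ = {0 < g < 1, 0 ≤ L ≤ 1 - (5/6)g}`, the (unique)
real solution `S̃` of the cubic `(1-g)·S̃ + g·S̃³/6 = L` is an approximate zero of
`f_{g,L}`. -/
theorem cubic_solution_is_approx_zero (g L S : ℝ) (hg0 : 0 < g) (hg1 : g < 1)
    (hL0 : 0 ≤ L) (hL1 : L ≤ 1 - 5 / 6 * g)
    (hS : (1 - g) * S + g * S ^ 3 / 6 = L) :
    ApproxZero (fhk g L) S := by
  have hS0 : 0 ≤ S := by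
    by_contra h
    push Not at h
    have : S ^ 3 < 0 := by nlinarith [sq_nonneg S, mul_pos_of_neg_of_neg h h]
    nlinarith [mul_pos_of_neg_of_neg h (show g - 1 < 0 by linarith)]
  have hS1 : S ≤ 1 := by
    by_contra h
    push Not at h
    have : 1 < S ^ 3 := one_lt_pow₀ h (by norm_num)
    nlinarith [mul_pos (sub_pos.2 h) (sub_pos.2 hg1)]
  obtain ⟨hD0, hD1⟩ := D_bounds S hS0 hS1
  have hfS : fhk g L S = -(g * (Real.arsinh S - S + S ^ 3 / 6)) := by
    unfold fhk; rw [← hS]; ring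
  set D := Real.arsinh S - S + S ^ 3 / 6
  have hp : 0 < 1 + S ^ 2 := by positivity
  have hs := Real.sq_sqrt hp.le
  have hs0 : 0 < √(1 + S ^ 2) := by positivity
  have hb := fun n => yf_bound n S
  have hf' : deriv (fhk g L) S = 1 - g * (√(1 + S ^ 2))⁻¹ := by rw [fhk_deriv]; rfl
  set r := √(1 + S ^ 2)
  have hr1 : 1 ≤ r := by nlinarith
  have hr2 : r ≤ √2 := Real.sqrt_le_sqrt (by nlinarith)
  have hrg : 0 < r - g := by linarith
  have hf'' : deriv (fhk g L) S = (r - g) / r := by rw [hf']; field_simp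
  set q := g / (r - g) with hq
  have hq0 : 0 < q := by positivity
  have hqS : q * S ^ 2 ≤ r + 1 := by
    have : q * (r - 1) ≤ 1 := by
      rw [hq, div_mul_eq_mul_div, div_le_one hrg]
      nlinarith
    have e : S ^ 2 = (r - 1) * (r + 1) := by linarith
    rw [e]; nlinarith
  have hqS0 : 0 ≤ q * S ^ 2 := by positivity
  set m := max 1 (q / 2) with hm
  have hm1 : 1 ≤ m := le_max_left _ _
  have hmq : q / 2 ≤ m := le_max_right _ _
  have hgam : gammaFn (fhk g L) S ≤ m / r := by
    unfold gammaFn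
    apply Real.sSup_le _ (by positivity)
    rintro y ⟨k, hk, rfl⟩
    obtain ⟨n, rfl⟩ := Nat.exists_eq_add_of_le' hk
    have hX : |iteratedDeriv (n + 2) (fhk g L) S /
        ((n + 2).factorial * deriv (fhk g L) S)| ≤ (m / r) ^ (n + 1) := by
      rw [fhk_iter, hf'', abs_div, abs_neg, abs_mul, abs_of_pos hg0, abs_mul, Nat.abs_cast,
        abs_of_pos (show 0 < (r - g) / r by positivity)]
      have hfp : (0 : ℝ) < (n + 1).factorial := by positivity
      have hfac : ((n + 2).factorial : ℝ) = (n + 2) * (n + 1).factorial := by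
        rw [Nat.factorial_succ (n + 1)]; push_cast; ring
      have hn : (0 : ℝ) ≤ n := Nat.cast_nonneg n
      calc g * |iteratedDeriv (n + 1) yf S| / ((n + 2).factorial * ((r - g) / r))
          ≤ g * ((n + 1).factorial / r ^ (n + 1 + 1)) / ((n + 2).factorial * ((r - g) / r)) := by
            gcongr; exact hb (n + 1)
        _ = q / (n + 2) / r ^ (n + 1) := by
            rw [hfac, hq]; field_simp; ring
        _ ≤ m / r ^ (n + 1) := by
            gcongr
            refine le_trans ?_ hmq
            gcongr; linarith
        _ ≤ m ^ (n + 1) / r ^ (n + 1) := by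
            gcongr
            exact le_self_pow₀ hm1 (by omega)
        _ = (m / r) ^ (n + 1) := by rw [div_pow]
    have hexp : (1 : ℝ) / (((n + 2 : ℕ) : ℝ) - 1) = ((n + 1 : ℕ) : ℝ)⁻¹ := by
      rw [one_div]; congr 1; push_cast; ring
    rw [hexp]
    calc _ ≤ ((m / r) ^ (n + 1)) ^ (((n + 1 : ℕ) : ℝ)⁻¹) :=
          Real.rpow_le_rpow (abs_nonneg _) hX (by positivity)
      _ = m / r := Real.pow_rpow_inv_natCast (by positivity) (by omega)
  have hbeta : betaFn (fhk g L) S = D * q * r := by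
    unfold betaFn
    rw [hfS, hf'', abs_div, abs_neg, abs_of_nonneg (by positivity),
      abs_of_pos (show 0 < (r - g) / r by positivity), hq]
    field_simp
  have hal : alphaFn (fhk g L) S ≤ D * q * m := by
    unfold alphaFn
    rw [hbeta]
    calc D * q * r * gammaFn (fhk g L) S ≤ D * q * r * (m / r) := by gcongr
      _ = D * q * m := by field_simp
  refine lt_of_le_of_lt hal ?_
  unfold alpha0
  have h2 := Real.sq_sqrt (show (0 : ℝ) ≤ 2 by norm_num)
  have h2a : √2 < 1.4143 := by
    rw [Real.sqrt_lt' (by norm_num)]; norm_num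
  have hDq : D * q ≤ 3 / 56 * S ^ 4 * q := by gcongr
  have hqS' : q * S ^ 2 ≤ 2.4143 := by linarith
  have hSS : S ^ 2 ≤ 1 := by nlinarith
  rcases le_total 1 (q / 2) with h | h
  · rw [hm, max_eq_right h]
    have : D * q * (q / 2) ≤ 3 / 56 * S ^ 4 * q * (q / 2) := by gcongr
    have e : 3 / 56 * S ^ 4 * q * (q / 2) = 3 / 112 * (q * S ^ 2) ^ 2 := by ring
    have e2 : (q * S ^ 2) ^ 2 ≤ 2.4143 ^ 2 := pow_le_pow_left₀ hqS0 hqS' 2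
    rw [e] at this
    norm_num at e2 h2a
    linarith
  · rw [hm, max_eq_left h]
    have e : 3 / 56 * S ^ 4 * q = 3 / 56 * S ^ 2 * (q * S ^ 2) := by ring
    have e2 : S ^ 2 * (q * S ^ 2) ≤ 1 * (q * S ^ 2) := by gcongr
    rw [e] at hDq
    norm_num at hqS' h2a
    linarith
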